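/- Assume H ≠ 0 and let η ∈ (0, 1/L]. Let z⁰ ∈ ∂B_{2n} and suppose w^k = z^k − η(Az^k + a) ≠ 0 for all k ≥ 0, where z^{k+1} = w^k/‖w^k‖. Then the sequence {z^k} converges to a point z̄ with z̄ᵀz̄ = 1 for which there exists μ ∈ ℝ with (A + μI)z̄ + a = 0. -/

import Mathlib

open Matrix Filter

/-- A bounded real sequence with vanishing increments along which a continuous function with nowhere
dense zero set tends to zero is convergent. -/
theorem exists_tendsto_of_slowly_varying {u : ℕ → ℝ} {f : ℝ → ℝ} {C : ℝ} (hf : Continuous f)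
    (hd : Dense {x | f x ≠ 0}) (hb : ∀ k, |u k| ≤ C)
    (hu : Tendsto (fun k => u (k + 1) - u k) atTop (nhds 0))
    (hfu : Tendsto (fun k => f (u k)) atTop (nhds 0)) :
    ∃ l, Tendsto u atTop (nhds l) := by
  refine tendsto_of_no_upcrossings dense_univ (fun a _ b _ hab => ?_)
    (isBoundedUnder_of ⟨C, fun k => (abs_le.1 (hb k)).2⟩)
    (isBoundedUnder_of ⟨-C, fun k => (abs_le.1 (hb k)).1⟩)
  rintro ⟨hfa, hfb⟩
  obtain ⟨x, hx, hax, hxb⟩ := hd.exists_between hab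
  have hx : 0 < |f x| := abs_pos.2 hx
  have hnear : ∀ᶠ y in nhds x, |f x| / 2 < |f y| :=
    (hf.abs.tendsto x).eventually (lt_mem_nhds (by linarith))
  obtain ⟨δ, hδ, hball⟩ := Metric.eventually_nhds_iff.1 hnear
  have hstep : ∀ᶠ k in atTop, |u (k + 1) - u k| < δ := by
    have := hu.abs
    rw [abs_zero] at this
    exact this.eventually (gt_mem_nhds hδ)
  have hval : ∀ᶠ k in atTop, |f (u k)| < |f x| / 2 := by
    have := hfu.abs
    rw [abs_zero] at this
    exact this.eventually (gt_mem_nhds (by linarith))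
  obtain ⟨K, hK⟩ := eventually_atTop.1 (hstep.and hval)
  obtain ⟨k, hk, hka⟩ := frequently_atTop.1 hfa K
  have hfar : ∀ j ≥ K, δ ≤ |u j - x| := by
    intro j hj
    by_contra! h
    have := hball (y := u j) (by rwa [Real.dist_eq])
    linarith [(hK j hj).2]
  have hbelow : ∀ j ≥ k, u j < x := by
    intro j hj
    induction j, hj using Nat.le_induction with
    | base => linarith
    | succ j hj ih =>
      have h1 := hfar j (hk.trans hj)
      rw [abs_of_neg (by linarith)] at h1
      have h2 := (abs_lt.1 (hK j (hk.trans hj)).1).2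
      linarith
  obtain ⟨j, hj, hjb⟩ := frequently_atTop.1 hfb k
  linarith [hbelow j hj]

section DiagonalIteration

variable {ι : Type*} [Fintype ι] {m b : ι → ℝ} {z : ℕ → ι → ℝ} {r : ℕ → ℝ}

theorem abs_le_one_of_sum_sq_eq_one {x : ι → ℝ} (hx : ∑ i, x i ^ 2 = 1) (i : ι) : |x i| ≤ 1 := by
  rw [← sq_le_one_iff_abs_le_one, ← hx]
  exact Finset.single_le_sum (f := fun i => x i ^ 2) (fun j _ => sq_nonneg _) (Finset.mem_univ i)

/-- The objective increases along the iteration by at least `r k / 2` times the squared step. -/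
theorem diagonal_iteration_ascent (hm : ∀ i, 0 ≤ m i)
    (hz : ∀ k, ∑ i, z k i ^ 2 = 1) (hrec : ∀ k i, r k * z (k + 1) i = m i * z k i + b i) (k : ℕ) :
    r k / 2 * ∑ i, (z (k + 1) i - z k i) ^ 2 ≤
      ∑ i, (m i * z (k + 1) i ^ 2 / 2 + b i * z (k + 1) i) -
        ∑ i, (m i * z k i ^ 2 / 2 + b i * z k i) := by
  have h : ∑ i, (m i * z (k + 1) i ^ 2 / 2 + b i * z (k + 1) i) -
      ∑ i, (m i * z k i ^ 2 / 2 + b i * z k i) - r k / 2 * ∑ i, (z (k + 1) i - z k i) ^ 2 =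
      ∑ i, m i * (z (k + 1) i - z k i) ^ 2 / 2 +
        r k / 2 * (∑ i, z (k + 1) i ^ 2 - ∑ i, z k i ^ 2) := by
    simp only [← Finset.sum_sub_distrib, Finset.mul_sum, ← Finset.sum_add_distrib]
    refine Finset.sum_congr rfl fun i _ => ?_
    linear_combination (-(z (k + 1) i - z k i)) * hrec k i
  rw [hz, hz, sub_self, mul_zero, add_zero] at h
  have : 0 ≤ ∑ i, m i * (z (k + 1) i - z k i) ^ 2 / 2 :=
    Finset.sum_nonneg fun i _ => by have := hm i; positivity
  linarith

/-- A first-order lower bound for the objective in terms of the normalising factor. -/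
theorem diagonal_iteration_sub_le (hm : ∀ i, 0 ≤ m i) (hr : ∀ k, 0 < r k)
    (hz : ∀ k, ∑ i, z k i ^ 2 = 1) (hrec : ∀ k i, r k * z (k + 1) i = m i * z k i + b i) (k : ℕ) :
    ∑ i, (m i * z k i ^ 2 / 2 + b i * z k i) - ∑ i, (m i * z 0 i ^ 2 / 2 + b i * z 0 i) ≤
      2 * r k := by
  have h : ∑ i, (m i * z k i ^ 2 / 2 + b i * z k i) - ∑ i, (m i * z 0 i ^ 2 / 2 + b i * z 0 i) =
      ∑ i, (r k * (z (k + 1) i * z k i - z (k + 1) i * z 0 i) - m i * (z k i - z 0 i) ^ 2 / 2) := by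
    rw [← Finset.sum_sub_distrib]
    refine Finset.sum_congr rfl fun i _ => ?_
    linear_combination (-(z k i - z 0 i)) * hrec k i
  have h2 : ∑ i, (r k * (z (k + 1) i * z k i - z (k + 1) i * z 0 i) -
      m i * (z k i - z 0 i) ^ 2 / 2) ≤
      ∑ i, r k * (z (k + 1) i ^ 2 + z k i ^ 2 / 2 + z 0 i ^ 2 / 2) := by
    refine Finset.sum_le_sum fun i _ => ?_
    have h3 : 0 ≤ m i * (z k i - z 0 i) ^ 2 / 2 := by have := hm i; positivity
    have h4 : z (k + 1) i * z k i - z (k + 1) i * z 0 i ≤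
        z (k + 1) i ^ 2 + z k i ^ 2 / 2 + z 0 i ^ 2 / 2 := by
      nlinarith [sq_nonneg (z (k + 1) i - z k i), sq_nonneg (z (k + 1) i + z 0 i)]
    have := mul_le_mul_of_nonneg_left h4 (hr k).le
    linarith
  have h5 : ∑ i, r k * (z (k + 1) i ^ 2 + z k i ^ 2 / 2 + z 0 i ^ 2 / 2) = 2 * r k := by
    rw [← Finset.mul_sum, Finset.sum_add_distrib, Finset.sum_add_distrib, ← Finset.sum_div,
      ← Finset.sum_div, hz, hz, hz]
    ring
  linarith

theorem diagonal_iteration_eq_initial_of_fixed (hr : ∀ k, 0 < r k)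
    (hz : ∀ k, ∑ i, z k i ^ 2 = 1) (hrec : ∀ k i, r k * z (k + 1) i = m i * z k i + b i)
    (h01 : z 1 = z 0) (k : ℕ) : z k = z 0 := by
  induction k with
  | zero => rfl
  | succ k ih =>
    have h1 : ∀ i, r k * z (k + 1) i = r 0 * z 0 i := fun i => by
      have := hrec 0 i
      rw [zero_add, h01] at this
      rw [hrec, ih, this]
    have h2 : r k ^ 2 = r 0 ^ 2 := by
      calc r k ^ 2 = ∑ i, (r k * z (k + 1) i) ^ 2 := by
            simp only [mul_pow, ← Finset.mul_sum, hz, mul_one]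
        _ = ∑ i, (r 0 * z 0 i) ^ 2 := by simp only [h1]
        _ = r 0 ^ 2 := by simp only [mul_pow, ← Finset.mul_sum, hz, mul_one]
    have h3 : r k = r 0 := (pow_left_inj₀ (hr k).le (hr 0).le two_ne_zero).1 h2
    funext i
    exact mul_left_cancel₀ (hr 0).ne' (h3 ▸ h1 i)

theorem diagonal_iteration_step_tendsto_zero (hm : ∀ i, 0 ≤ m i) (hr : ∀ k, 0 < r k)
    (hz : ∀ k, ∑ i, z k i ^ 2 = 1) (hrec : ∀ k i, r k * z (k + 1) i = m i * z k i + b i) (i : ι) :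
    Tendsto (fun k => z (k + 1) i - z k i) atTop (nhds 0) := by
  by_cases h01 : z 1 = z 0
  · have h := diagonal_iteration_eq_initial_of_fixed hr hz hrec h01
    simp only [h, sub_self, tendsto_const_nhds]
  set g : ℕ → ℝ := fun k => ∑ i, (m i * z k i ^ 2 / 2 + b i * z k i) with hg
  have hasc : ∀ k, r k / 2 * ∑ i, (z (k + 1) i - z k i) ^ 2 ≤ g (k + 1) - g k :=
    diagonal_iteration_ascent hm hz hrec
  have hmono : Monotone g := monotone_nat_of_le_succ fun k => by
    have h1 := hasc k
    have h2 : 0 ≤ r k / 2 * ∑ i, (z (k + 1) i - z k i) ^ 2 :=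
      mul_nonneg (half_pos (hr k)).le (Finset.sum_nonneg fun i _ => sq_nonneg _)
    linarith
  have hbdd : BddAbove (Set.range g) := by
    refine ⟨∑ i, (m i / 2 + |b i|), ?_⟩
    rintro _ ⟨k, rfl⟩
    refine Finset.sum_le_sum fun i _ => add_le_add ?_ ?_
    · have h1 := (sq_le_one_iff_abs_le_one _).2 (abs_le_one_of_sum_sq_eq_one (hz k) i)
      nlinarith [mul_le_mul_of_nonneg_left h1 (hm i)]
    · calc b i * z k i ≤ |b i * z k i| := le_abs_self _
        _ = |b i| * |z k i| := abs_mul _ _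
        _ ≤ |b i| * 1 :=
            mul_le_mul_of_nonneg_left (abs_le_one_of_sum_sq_eq_one (hz k) i) (abs_nonneg _)
        _ = |b i| := mul_one _
  have hlim := tendsto_atTop_ciSup hmono hbdd
  have hdiff : Tendsto (fun k => g (k + 1) - g k) atTop (nhds 0) := by
    simpa using ((tendsto_add_atTop_iff_nat 1).2 hlim).sub hlim
  have hpos : 0 < g 1 - g 0 := by
    refine lt_of_lt_of_le (mul_pos (half_pos (hr 0)) ?_) (hasc 0)
    obtain ⟨j, hj⟩ := Function.ne_iff.1 h01
    exact Finset.sum_pos' (fun i _ => sq_nonneg _)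
      ⟨j, Finset.mem_univ j, sq_pos_of_ne_zero (sub_ne_zero.2 hj)⟩
  have hsq : Tendsto (fun k => (z (k + 1) i - z k i) ^ 2) atTop (nhds 0) := by
    have hdiff' := hdiff.const_mul (4 / (g 1 - g 0))
    rw [mul_zero] at hdiff'
    refine squeeze_zero' (Eventually.of_forall fun k => sq_nonneg _) ?_ hdiff'
    filter_upwards [eventually_ge_atTop 1] with k hk
    have h1 : g k - g 0 ≤ 2 * r k := diagonal_iteration_sub_le hm hr hz hrec k
    have h2 := hmono hk
    have h3 : (z (k + 1) i - z k i) ^ 2 ≤ ∑ i, (z (k + 1) i - z k i) ^ 2 :=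
      Finset.single_le_sum (f := fun i => (z (k + 1) i - z k i) ^ 2) (fun j _ => sq_nonneg _)
        (Finset.mem_univ i)
    have h4 := hasc k
    have h5 : (g 1 - g 0) / 4 * (z (k + 1) i - z k i) ^ 2 ≤ g (k + 1) - g k := by
      refine le_trans (mul_le_mul ?_ h3 (sq_nonneg _) (half_pos (hr k)).le) h4
      linarith
    rw [div_mul_eq_mul_div, le_div_iff₀ hpos]
    linarith
  have := hsq.sqrt
  simp only [Real.sqrt_sq_eq_abs, Real.sqrt_zero] at this
  exact (tendsto_zero_iff_abs_tendsto_zero _).2 this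

/-- The polynomial whose real roots contain all multipliers of critical points on the sphere. -/
noncomputable def secularPolynomial [DecidableEq ι] (m b : ι → ℝ) : Polynomial ℝ :=
  ∏ j, (Polynomial.X - Polynomial.C (m j)) ^ 2 -
    ∑ i, Polynomial.C (b i ^ 2) *
      ∏ j ∈ Finset.univ.erase i, (Polynomial.X - Polynomial.C (m j)) ^ 2

theorem secularPolynomial_ne_zero [DecidableEq ι] (m b : ι → ℝ) : secularPolynomial m b ≠ 0 := by
  have hmon : ∀ s : Finset ι, (∏ j ∈ s, (Polynomial.X - Polynomial.C (m j)) ^ 2).Monic :=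
    fun s => Polynomial.monic_prod_of_monic _ _ fun j _ => (Polynomial.monic_X_sub_C _).pow 2
  have hdeg : ∀ s : Finset ι, (∏ j ∈ s, (Polynomial.X - Polynomial.C (m j)) ^ 2).degree =
      ((2 * s.card : ℕ) : WithBot ℕ) := fun s => by
    rw [Polynomial.degree_eq_natDegree (hmon s).ne_zero, Polynomial.natDegree_prod_of_monic _ _
      fun j _ => (Polynomial.monic_X_sub_C _).pow 2]
    simp [mul_comm]
  refine ((hmon Finset.univ).sub_of_left ?_).ne_zero
  refine lt_of_le_of_lt (Polynomial.degree_sum_le _ _) ((Finset.sup_lt_iff ?_).2 fun i _ => ?_)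
  · rw [hdeg]
    exact WithBot.bot_lt_coe _
  · refine lt_of_le_of_lt
      ((Polynomial.degree_mul_le _ _).trans (add_le_add_left Polynomial.degree_C_le _)) ?_
    rw [zero_add]
    rw [hdeg, hdeg]
    have := Finset.card_erase_lt_of_mem (Finset.mem_univ i)
    exact_mod_cast (by omega)

theorem secularPolynomial_eval [DecidableEq ι] {x : ι → ℝ} (hx : ∑ i, x i ^ 2 = 1) (t : ℝ) :
    (secularPolynomial m b).eval t =
      ∑ i, (((t - m i) * x i) ^ 2 - b i ^ 2) * ∏ j ∈ Finset.univ.erase i, (t - m j) ^ 2 := by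
  have h : ∏ j, (t - m j) ^ 2 =
      ∑ i, ((t - m i) * x i) ^ 2 * ∏ j ∈ Finset.univ.erase i, (t - m j) ^ 2 := by
    calc ∏ j, (t - m j) ^ 2 = ∑ i, x i ^ 2 * ∏ j, (t - m j) ^ 2 := by
          rw [← Finset.sum_mul, hx, one_mul]
      _ = _ := by
          refine Finset.sum_congr rfl fun i _ => ?_
          rw [← Finset.mul_prod_erase _ _ (Finset.mem_univ i)]
          ring
  simp only [secularPolynomial, Polynomial.eval_sub, Polynomial.eval_prod, Polynomial.eval_pow,
    Polynomial.eval_X, Polynomial.eval_C, Polynomial.eval_finsetSum, Polynomial.eval_mul,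
    sub_mul, Finset.sum_sub_distrib, h]

theorem tendsto_zero_mul_of_abs_le {u v : ℕ → ℝ} {C : ℝ} (hu : Tendsto u atTop (nhds 0))
    (hv : ∀ k, |v k| ≤ C) : Tendsto (fun k => u k * v k) atTop (nhds 0) :=
  hu.zero_mul_isBoundedUnder_le (isBoundedUnder_of ⟨C, hv⟩)

theorem abs_mul_add_le (hm : ∀ i, 0 ≤ m i) (hz : ∀ k, ∑ i, z k i ^ 2 = 1) (k : ℕ) (i : ι) :
    |m i * z k i + b i| ≤ m i + |b i| := by
  refine (abs_add_le _ _).trans (add_le_add ?_ le_rfl)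
  rw [abs_mul, abs_of_nonneg (hm i)]
  exact mul_le_of_le_one_right (hm i) (abs_le_one_of_sum_sq_eq_one (hz k) i)

theorem diagonal_iteration_factor_eq
    (hz : ∀ k, ∑ i, z k i ^ 2 = 1) (hrec : ∀ k i, r k * z (k + 1) i = m i * z k i + b i) (k : ℕ) :
    r k = ∑ i, (m i * z k i + b i) * z (k + 1) i := by
  calc r k = ∑ i, r k * z (k + 1) i ^ 2 := by rw [← Finset.mul_sum, hz, mul_one]
    _ = _ := Finset.sum_congr rfl fun i _ => by rw [← hrec]; ring

theorem diagonal_iteration_factor_bounded (hm : ∀ i, 0 ≤ m i)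
    (hz : ∀ k, ∑ i, z k i ^ 2 = 1) (hrec : ∀ k i, r k * z (k + 1) i = m i * z k i + b i) (k : ℕ) :
    |r k| ≤ ∑ i, (m i + |b i|) := by
  rw [diagonal_iteration_factor_eq hz hrec k]
  refine (Finset.abs_sum_le_sum_abs _ _).trans (Finset.sum_le_sum fun i _ => ?_)
  rw [abs_mul]
  exact (mul_le_of_le_one_right (abs_nonneg _) (abs_le_one_of_sum_sq_eq_one (hz _) i)).trans
    (abs_mul_add_le hm hz k i)

theorem diagonal_iteration_residual_tendsto_zero (hm : ∀ i, 0 ≤ m i) (hr : ∀ k, 0 < r k)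
    (hz : ∀ k, ∑ i, z k i ^ 2 = 1) (hrec : ∀ k i, r k * z (k + 1) i = m i * z k i + b i) (i : ι) :
    Tendsto (fun k => (r k - m i) * z k i - b i) atTop (nhds 0) := by
  have hneg := (diagonal_iteration_step_tendsto_zero hm hr hz hrec i).neg
  rw [neg_zero] at hneg
  have h := tendsto_zero_mul_of_abs_le hneg (diagonal_iteration_factor_bounded hm hz hrec)
  refine h.congr fun k => ?_
  linear_combination -hrec k i

theorem diagonal_iteration_factor_converges (hm : ∀ i, 0 ≤ m i) (hr : ∀ k, 0 < r k)
    (hz : ∀ k, ∑ i, z k i ^ 2 = 1) (hrec : ∀ k i, r k * z (k + 1) i = m i * z k i + b i) :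
    ∃ R, Tendsto r atTop (nhds R) := by
  classical
  have hΔ := diagonal_iteration_step_tendsto_zero hm hr hz hrec
  have hrb := diagonal_iteration_factor_bounded hm hz hrec
  refine exists_tendsto_of_slowly_varying (f := fun t => (secularPolynomial m b).eval t)
    (Polynomial.continuous _) ?_ hrb ?_ ?_
  · have hfin : {t | (secularPolynomial m b).IsRoot t}.Finite :=
      Polynomial.finite_setOfPred_isRoot (secularPolynomial_ne_zero m b)
    exact hfin.countable.dense_compl ℝ
  · have h : Tendsto (fun k => ∑ i, ((z (k + 1 + 1) i - z (k + 1) i) * (m i * z (k + 1) i + b i) +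
        (z (k + 1) i - z k i) * (m i * z (k + 1) i))) atTop (nhds (∑ i : ι, (0 + 0))) := by
      refine tendsto_finsetSum _ fun i _ => Tendsto.add ?_ ?_
      · exact tendsto_zero_mul_of_abs_le ((tendsto_add_atTop_iff_nat 1).2 (hΔ i))
          fun k => abs_mul_add_le hm hz (k + 1) i
      · refine tendsto_zero_mul_of_abs_le (C := m i) (hΔ i) fun k => ?_
        simpa using abs_mul_add_le (b := 0) hm hz (k + 1) i
    simp only [add_zero, Finset.sum_const_zero] at h
    refine h.congr fun k => ?_
    rw [diagonal_iteration_factor_eq hz hrec k, diagonal_iteration_factor_eq hz hrec (k + 1),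
      ← Finset.sum_sub_distrib]
    exact Finset.sum_congr rfl fun i _ => by ring
  · have h : Tendsto (fun k => ∑ i, ((r k - m i) * z k i - b i) *
        (((r k - m i) * z k i + b i) * ∏ j ∈ Finset.univ.erase i, (r k - m j) ^ 2)) atTop
        (nhds (∑ i : ι, 0)) := by
      refine tendsto_finsetSum _ fun i _ => ?_
      set C := ∑ i, (m i + |b i|)
      have hC : ∀ k j, |r k - m j| ≤ C + m j := fun k j =>
        (abs_sub _ _).trans (add_le_add (hrb k) (abs_of_nonneg (hm j)).le)
      refine tendsto_zero_mul_of_abs_le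
        (C := ((C + m i) * 1 + |b i|) * ∏ j ∈ Finset.univ.erase i, (C + m j) ^ 2)
        (diagonal_iteration_residual_tendsto_zero hm hr hz hrec i) fun k => ?_
      rw [abs_mul, Finset.abs_prod]
      have h0 : ∀ j, 0 ≤ C + m j := fun j => (abs_nonneg _).trans (hC k j)
      refine mul_le_mul ((abs_add_le _ _).trans (add_le_add ?_ le_rfl))
        (Finset.prod_le_prod (fun j _ => abs_nonneg _) fun j _ => ?_)
        (Finset.prod_nonneg fun j _ => abs_nonneg _) ?_
      · rw [abs_mul]
        exact mul_le_mul (hC k i) (abs_le_one_of_sum_sq_eq_one (hz k) i) (abs_nonneg _) (h0 i)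
      · rw [abs_pow]
        exact pow_le_pow_left₀ (abs_nonneg _) (hC k j) 2
      · have := h0 i
        positivity
    rw [Finset.sum_const_zero] at h
    refine h.congr fun k => ?_
    rw [secularPolynomial_eval (hz k)]
    exact Finset.sum_congr rfl fun i _ => by ring

/-- The normalised iteration `r k • z (k + 1) = diagonal m *ᵥ z k + b` on the unit sphere, with
`m ≥ 0` and `r > 0`, converges, and so do its normalising factors. -/
theorem diagonal_iteration_converges (hm : ∀ i, 0 ≤ m i) (hr : ∀ k, 0 < r k)
    (hz : ∀ k, ∑ i, z k i ^ 2 = 1) (hrec : ∀ k i, r k * z (k + 1) i = m i * z k i + b i) :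
    ∃ y R, Tendsto z atTop (nhds y) ∧ Tendsto r atTop (nhds R) := by
  classical
  obtain ⟨R, hR⟩ := diagonal_iteration_factor_converges hm hr hz hrec
  have hres := diagonal_iteration_residual_tendsto_zero hm hr hz hrec
  have hR0 : 0 ≤ R := ge_of_tendsto' hR fun k => (hr k).le
  have hne : ∀ i, m i ≠ R → Tendsto (fun k => z k i) atTop (nhds (b i / (R - m i))) := by
    intro i hi
    have hRi : R - m i ≠ 0 := sub_ne_zero.2 (Ne.symm hi)
    have h1 := hR.sub_const (m i)
    have h2 := ((hres i).add_const (b i)).div h1 hRi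
    rw [zero_add] at h2
    refine h2.congr' ?_
    filter_upwards [h1.eventually_ne hRi] with k hk
    simp only [Pi.div_apply, sub_add_cancel]
    rw [mul_div_cancel_left₀ _ hk]
  have hb0 : ∀ i, m i = R → b i = 0 := by
    intro i hi
    have h1 : Tendsto (fun k => r k - m i) atTop (nhds 0) := by
      simpa [hi] using hR.sub_const (m i)
    have h2 := tendsto_zero_mul_of_abs_le h1 (fun k => abs_le_one_of_sum_sq_eq_one (hz k) i)
    have h3 := tendsto_nhds_unique (h2.sub_const (b i)) (hres i)
    linarith
  set p : ℕ → ℝ := fun k => ∏ j ∈ Finset.range k, (R / r j) with hp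
  have hp0 : ∀ k, 0 ≤ p k := fun k => Finset.prod_nonneg fun j _ => div_nonneg hR0 (hr j).le
  have hzp : ∀ i, m i = R → ∀ k, z k i = p k * z 0 i := by
    intro i hi k
    induction k with
    | zero => simp [hp]
    | succ k ih =>
      have h1 := hrec k i
      rw [hb0 i hi, add_zero, hi] at h1
      have h2 : p (k + 1) = p k * (R / r k) := Finset.prod_range_succ _ _
      have := (hr k).ne'
      rw [h2]
      field_simp
      linear_combination h1 + R * ih
  suffices ∀ i, ∃ l, Tendsto (fun k => z k i) atTop (nhds l) by
    choose y hy using this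
    exact ⟨y, R, tendsto_pi_nhds.2 hy, hR⟩
  intro i
  by_cases hi : m i = R
  swap
  · exact ⟨_, hne i hi⟩
  set S : ℝ := ∑ j with m j = R, z 0 j ^ 2 with hS
  by_cases hS0 : S = 0
  · have h0 : z 0 i = 0 := by
      have := (Finset.sum_eq_zero_iff_of_nonneg fun j _ => sq_nonneg _).1 hS0 i (by simpa using hi)
      simpa using this
    refine ⟨0, ?_⟩
    refine tendsto_const_nhds.congr fun k => ?_
    rw [hzp i hi, h0, mul_zero]
  have hpk : ∀ k, p k = √((1 - ∑ j with ¬ m j = R, z k j ^ 2) / S) := by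
    intro k
    have h1 := Finset.sum_filter_add_sum_filter_not Finset.univ (fun j => m j = R)
      (fun j => z k j ^ 2)
    have h2 : ∑ j with m j = R, z k j ^ 2 = p k ^ 2 * S := by
      rw [hS, Finset.mul_sum]
      refine Finset.sum_congr rfl fun j hj => ?_
      rw [hzp j (by simpa using hj) k, mul_pow]
    rw [hz, h2] at h1
    rw [← h1, add_sub_cancel_right, mul_div_cancel_right₀ _ hS0, Real.sqrt_sq (hp0 k)]
  refine ⟨√((1 - ∑ j with ¬ m j = R, (b j / (R - m j)) ^ 2) / S) * z 0 i, ?_⟩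
  refine Tendsto.congr (fun k => (hzp i hi k).symm) (Tendsto.mul_const _ ?_)
  refine Tendsto.congr (fun k => (hpk k).symm)
    (Tendsto.sqrt (Tendsto.div_const (tendsto_const_nhds.sub ?_) S))
  exact tendsto_finsetSum _ fun j hj => (hne j (by simpa using hj)).pow 2

end DiagonalIteration

/-- Projected gradient iteration for a quadratic on the unit sphere: if the step size is at most the
reciprocal of the largest eigenvalue, then the iterates and the normalising factors converge. -/
theorem projected_gradient_converges {ι : Type*} [Fintype ι] {A : Matrix ι ι ℝ} (hA : A.IsHermitian)
    {a : ι → ℝ} {η : ℝ} (hη : ∀ x, η * (x ⬝ᵥ A *ᵥ x) ≤ x ⬝ᵥ x) {z : ℕ → ι → ℝ} {r : ℕ → ℝ}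
    (hr : ∀ k, 0 < r k) (hz : ∀ k, z k ⬝ᵥ z k = 1)
    (hrec : ∀ k, r k • z (k + 1) = z k - η • (A *ᵥ z k + a)) :
    ∃ y R, Tendsto z atTop (nhds y) ∧ Tendsto r atTop (nhds R) := by
  classical
  obtain ⟨U, d, hUU, hUU', hAU⟩ : ∃ (U : Matrix ι ι ℝ) (d : ι → ℝ), Uᵀ * U = 1 ∧ U * Uᵀ = 1 ∧
      Uᵀ * A = diagonal d * Uᵀ := by
    have h1 : (hA.eigenvectorUnitary : Matrix ι ι ℝ)ᵀ * hA.eigenvectorUnitary = 1 := by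
      simpa [star_eq_conjTranspose] using Unitary.coe_star_mul_self hA.eigenvectorUnitary
    refine ⟨hA.eigenvectorUnitary, hA.eigenvalues, h1, mul_eq_one_comm.1 h1, ?_⟩
    have h2 := hA.spectral_theorem
    rw [Unitary.conjStarAlgAut_apply] at h2
    have h3 : A = (hA.eigenvectorUnitary : Matrix ι ι ℝ) * diagonal hA.eigenvalues *
        (hA.eigenvectorUnitary : Matrix ι ι ℝ)ᵀ := by
      simpa [star_eq_conjTranspose, Function.comp_def] using h2
    refine (congrArg ((hA.eigenvectorUnitary : Matrix ι ι ℝ)ᵀ * ·) h3).trans ?_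
    rw [← mul_assoc, ← mul_assoc, h1, one_mul]
  have hd : ∀ i, 0 ≤ 1 - η * d i := by
    intro i
    have h1 := hη (U *ᵥ Pi.single i 1)
    have h2 : ∀ x y, U *ᵥ x ⬝ᵥ y = x ⬝ᵥ Uᵀ *ᵥ y := fun x y => by
      rw [dotProduct_mulVec, vecMul_transpose]
    rw [h2, h2, mulVec_mulVec, mulVec_mulVec, mulVec_mulVec, hAU, mul_assoc, hUU, mul_one,
      one_mulVec, single_one_dotProduct, single_one_dotProduct, mulVec_diagonal,
      Pi.single_eq_same, mul_one] at h1
    linarith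
  obtain ⟨y, R, hy, hR⟩ := diagonal_iteration_converges (m := fun i => 1 - η * d i)
    (b := fun i => -(η * (Uᵀ *ᵥ a) i)) (z := fun k => Uᵀ *ᵥ z k) (r := r) hd hr
    (fun k => by
      have h : Uᵀ *ᵥ z k ⬝ᵥ Uᵀ *ᵥ z k = 1 := by
        rw [dotProduct_mulVec, vecMul_transpose, mulVec_mulVec, hUU', one_mulVec, hz]
      simpa [dotProduct, sq] using h)
    (fun k i => by
      have h := congrFun (congrArg (Uᵀ *ᵥ ·) (hrec k)) i
      simp only [mulVec_smul, mulVec_sub, mulVec_add, mulVec_mulVec, hAU] at h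
      rw [← mulVec_mulVec] at h
      simp only [Pi.smul_apply, Pi.sub_apply, Pi.add_apply, smul_eq_mul, mulVec_diagonal] at h
      linear_combination h)
  refine ⟨U *ᵥ y, R, ?_, hR⟩
  have hcont : Continuous fun x : ι → ℝ => U *ᵥ x := continuous_const.matrix_mulVec continuous_id
  refine ((hcont.tendsto y).comp hy).congr fun k => ?_
  simp only [Function.comp_apply, mulVec_mulVec, hUU', one_mulVec]

/-- Convergence of (PGe2) on the unit sphere: for `H ≠ 0` symmetric with spectral
norm `L`, step size `η ∈ (0, 1/L]`, initial point `z⁰` on the sphere, and with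
`w^k = z^k − η(Az^k + a) ≠ 0` for all `k` (where `z^{k+1} = w^k/‖w^k‖`), the
sequence `{z^k}` converges to a point `z̄` with `z̄ᵀz̄ = 1` satisfying
`(A + μI)z̄ + a = 0` for some `μ ∈ ℝ`. Here `A = diag(H, H)`, `a = (c, 0)` on
`ℝ^{2n} = (Fin n ⊕ Fin n) → ℝ`, and `L = ‖H‖₂` is characterized by the
quadratic-form bound together with attainment at an eigenvector. -/
theorem stmt_13 {n : ℕ} (H : Matrix (Fin n) (Fin n) ℝ) (hH : H.IsSymm) (hH0 : H ≠ 0)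
    (c : Fin n → ℝ) (L : ℝ)
    (hL1 : ∀ x : Fin n → ℝ, |x ⬝ᵥ (H *ᵥ x)| ≤ L * (x ⬝ᵥ x))
    (hL2 : ∃ v : Fin n → ℝ, v ≠ 0 ∧ (H *ᵥ v = L • v ∨ H *ᵥ v = (-L) • v))
    (η : ℝ) (hη0 : 0 < η) (hη1 : η ≤ 1 / L)
    (A : Matrix (Fin n ⊕ Fin n) (Fin n ⊕ Fin n) ℝ) (hA : A = Matrix.fromBlocks H 0 0 H)
    (a : Fin n ⊕ Fin n → ℝ) (ha : a = Sum.elim c 0)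
    (step : (Fin n ⊕ Fin n → ℝ) → (Fin n ⊕ Fin n → ℝ))
    (hstep : ∀ z, step z =
      (Real.sqrt ((z - η • (A *ᵥ z + a)) ⬝ᵥ (z - η • (A *ᵥ z + a))))⁻¹ •
        (z - η • (A *ᵥ z + a)))
    (z0 : Fin n ⊕ Fin n → ℝ) (hz0 : z0 ⬝ᵥ z0 = 1)
    (hw : ∀ k : ℕ, step^[k] z0 - η • (A *ᵥ (step^[k] z0) + a) ≠ 0) :
    ∃ zbar : Fin n ⊕ Fin n → ℝ, zbar ⬝ᵥ zbar = 1 ∧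
      (∃ μ : ℝ,
        (A + μ • (1 : Matrix (Fin n ⊕ Fin n) (Fin n ⊕ Fin n) ℝ)) *ᵥ zbar + a = 0) ∧
      Tendsto (fun k => step^[k] z0) atTop (nhds zbar) := by
  have hL : 0 < L := by
    by_contra! h
    linarith [one_div_nonpos.2 h]
  have hηL : η * L ≤ 1 := (le_div_iff₀ hL).1 hη1
  have hAherm : A.IsHermitian := by
    rw [hA, IsHermitian, conjTranspose_eq_transpose_of_trivial, fromBlocks_transpose, hH.eq]
    simp
  have hbound : ∀ x : Fin n ⊕ Fin n → ℝ, η * (x ⬝ᵥ A *ᵥ x) ≤ x ⬝ᵥ x := by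
    intro x
    have hx : x ⬝ᵥ A *ᵥ x = (x ∘ Sum.inl) ⬝ᵥ H *ᵥ (x ∘ Sum.inl) +
        (x ∘ Sum.inr) ⬝ᵥ H *ᵥ (x ∘ Sum.inr) := by
      rw [hA, fromBlocks_mulVec]
      simp [dotProduct]
    have hxx : x ⬝ᵥ x = (x ∘ Sum.inl) ⬝ᵥ (x ∘ Sum.inl) + (x ∘ Sum.inr) ⬝ᵥ (x ∘ Sum.inr) := by
      simp [dotProduct]
    have h1 := (le_abs_self _).trans (hL1 (x ∘ Sum.inl))
    have h2 := (le_abs_self _).trans (hL1 (x ∘ Sum.inr))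
    have h3 : 0 ≤ x ⬝ᵥ x := by
      simpa [dotProduct] using Finset.sum_nonneg fun i (_ : i ∈ Finset.univ) => mul_self_nonneg (x i)
    calc η * (x ⬝ᵥ A *ᵥ x) ≤ η * (L * (x ⬝ᵥ x)) := by
          refine mul_le_mul_of_nonneg_left ?_ hη0.le
          rw [hx, hxx, mul_add]
          exact add_le_add h1 h2
      _ = η * L * (x ⬝ᵥ x) := by ring
      _ ≤ x ⬝ᵥ x := mul_le_of_le_one_left h3 hηL
  set w : ℕ → Fin n ⊕ Fin n → ℝ := fun k => step^[k] z0 - η • (A *ᵥ (step^[k] z0) + a) with hwdef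
  have hr : ∀ k, 0 < √(w k ⬝ᵥ w k) := fun k => by
    refine Real.sqrt_pos.2 (lt_of_le_of_ne ?_ fun h => hw k (dotProduct_self_eq_zero.1 h.symm))
    exact Finset.sum_nonneg fun i _ => mul_self_nonneg _
  have hsucc : ∀ k, step^[k + 1] z0 = (√(w k ⬝ᵥ w k))⁻¹ • w k := fun k => by
    rw [Function.iterate_succ_apply', hstep]
  have hz : ∀ k, step^[k] z0 ⬝ᵥ step^[k] z0 = 1 := by
    rintro (_ | k)
    · exact hz0
    · rw [hsucc, smul_dotProduct, dotProduct_smul, smul_eq_mul, smul_eq_mul, ← mul_assoc, ← mul_inv,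
        Real.mul_self_sqrt (Real.sqrt_pos.1 (hr k)).le]
      exact inv_mul_cancel₀ (Real.sqrt_pos.1 (hr k)).ne'
  have hrec : ∀ k, √(w k ⬝ᵥ w k) • step^[k + 1] z0 = w k := fun k => by
    rw [hsucc, smul_inv_smul₀ (hr k).ne']
  obtain ⟨y, R, hy, hR⟩ := projected_gradient_converges hAherm hbound hr hz hrec
  have hy1 : y ⬝ᵥ y = 1 := by
    have hcont : Continuous fun x : Fin n ⊕ Fin n → ℝ => x ⬝ᵥ x :=
      continuous_id.dotProduct continuous_id
    refine tendsto_nhds_unique ((hcont.tendsto y).comp hy) (tendsto_const_nhds.congr fun k => ?_)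
    exact (hz k).symm
  have hlim : R • y = y - η • (A *ᵥ y + a) := by
    have hcont : Continuous fun x : Fin n ⊕ Fin n → ℝ => x - η • (A *ᵥ x + a) :=
      continuous_id.sub (((continuous_const.matrix_mulVec continuous_id).add
        continuous_const).const_smul η)
    refine tendsto_nhds_unique (hR.smul ((tendsto_add_atTop_iff_nat 1).2 hy)) ?_
    exact ((hcont.tendsto y).comp hy).congr fun k => (hrec k).symm
  refine ⟨y, hy1, ⟨(R - 1) / η, ?_⟩, hy⟩
  funext i
  have h := congrFun hlim i
  simp only [Pi.smul_apply, Pi.sub_apply, Pi.add_apply, smul_eq_mul] at h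
  simp only [add_mulVec, smul_mulVec, one_mulVec, Pi.add_apply, Pi.smul_apply, smul_eq_mul,
    Pi.zero_apply]
  field_simp
  linear_combination h
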